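/- arXiv:2004.13302 — 2 statements merged into one kernel-verified Lean document; each statement's English description precedes it below -/
import Mathlib

section
/- Let H be a non-empty finite subgraph of T_∞, all of whose connected components are ungrounded. Then ∂(H) ≥ (|E(H)| + 3)/2. -/
open scoped Classical

noncomputable section

namespace Paper

/-- A join-tree: a finite rooted binary tree whose leaves are labeled by
edges (elements of `Sym2 α`) or by `⊥` (here `none`). -/
inductive JoinTree (α : Type*) where
  | leaf : Option (Sym2 α) → JoinTree α
  | node : JoinTree α → JoinTree α → JoinTree α

variable {V : Type*}

/-- The vertex set of a finite edge set (a finite subgraph given by its edges). -/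
def vset (F : Finset (Sym2 V)) : Set V := {v | ∃ e ∈ F, v ∈ e}

lemma vset_mono {F F' : Finset (Sym2 V)} (h : F ⊆ F') : vset F ⊆ vset F' := by
  rintro v ⟨e, he, hv⟩
  exact ⟨e, h he, hv⟩

/-- `Δ_θ(F) = |V(F)| − Σ_{e ∈ E(F)} θ(e)`. -/
def Delta (θ : Sym2 V → ℝ) (F : Finset (Sym2 V)) : ℝ :=
  ((vset F).ncard : ℝ) - ∑ e ∈ F, θ e

/-- `θ` is a threshold weighting on the graph with edge set `E`:
it takes values in `[0,2]` on `E`, `Δ_θ(F) ≥ 0` for every finite subgraph `F ⊆ E`,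
and `Δ_θ(E) = 0` whenever `E` is finite. -/
def IsThresholdWeighting (E : Set (Sym2 V)) (θ : Sym2 V → ℝ) : Prop :=
  (∀ e ∈ E, 0 ≤ θ e ∧ θ e ≤ 2) ∧
  (∀ F : Finset (Sym2 V), (F : Set (Sym2 V)) ⊆ E → 0 ≤ Delta θ F) ∧
  (∀ hE : E.Finite, Delta θ hE.toFinset = 0)

/-- `F ⊖ S`: the union of the connected components of `F` that are vertex-disjoint
from `S`. -/
def elimS (F : Finset (Sym2 V)) (S : Set V) : Finset (Sym2 V) :=
  F.filter fun e =>
    ∀ v ∈ e, ∀ s ∈ S, ¬ (SimpleGraph.fromEdgeSet (F : Set (Sym2 V))).Reachable v s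

/-- The graph with edge set `F` is connected. -/
def ConnE (F : Finset (Sym2 V)) : Prop :=
  ∀ u ∈ vset F, ∀ w ∈ vset F, (SimpleGraph.fromEdgeSet (F : Set (Sym2 V))).Reachable u w

/-- The subgraph of `F` induced on a vertex set `T`. -/
def induced (F : Finset (Sym2 V)) (T : Set V) : Finset (Sym2 V) :=
  F.filter fun e => ∀ v ∈ e, v ∈ T

/-- Vertices of the infinite rootless layered binary tree `T_∞`: `(j, m)` is the
`m`-th vertex of level `j` (level `0` is the leaf level). -/
abbrev Vtx : Type := ℕ × ℕ

/-- The parent of a vertex of `T_∞`. -/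
def parentV (v : Vtx) : Vtx := (v.1 + 1, v.2 / 2)

/-- The edge set of `T_∞`: each vertex is joined to its parent. -/
def ETinf : Set (Sym2 Vtx) := { e | ∃ v : Vtx, e = s(v, parentV v) }

/-- `Desc v x`: `v` is a vertex of the complete binary tree `T_x` rooted at `x`
(i.e. a descendant of `x`, including `x` itself). -/
def Desc (v x : Vtx) : Prop := v.1 ≤ x.1 ∧ v.2 / 2 ^ (x.1 - v.1) = x.2

/-- The edge set of the complete binary tree `T_x` rooted at `x` inside `T_∞`. -/
def TxE (x : Vtx) : Set (Sym2 Vtx) :=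
  { e | ∃ v : Vtx, Desc v x ∧ v ≠ x ∧ e = s(v, parentV v) }

/-- The edge set of `T_x^+`: `T_x` together with the edge from `x` to its parent. -/
def TxPlusE (x : Vtx) : Set (Sym2 Vtx) := TxE x ∪ {s(x, parentV x)}

/-- `T_x ⊆ F` as subgraphs of `T_∞` (for `x` of level `0`, `T_x` is the single
vertex `x`, and containment means `x ∈ V(F)`). -/
def TxCont (x : Vtx) (F : Finset (Sym2 Vtx)) : Prop :=
  TxE x ⊆ (F : Set (Sym2 Vtx)) ∧ (x.1 = 0 → x ∈ vset F)

/-- The max-complete height `λ(F)`: the largest `k` such that `T_x ⊆ F` for some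
vertex `x` of level `k` (and `0` if there is no such `x`). -/
def lam (F : Finset (Sym2 Vtx)) : ℕ := sSup { k | ∃ x : Vtx, x.1 = k ∧ TxCont x F }

/-- The boundary size `∂(F) = |V(F) ∩ V(T_∞ \ F)|`. -/
def bdry (F : Finset (Sym2 Vtx)) : ℕ :=
  (vset F ∩ {v | ∃ e ∈ ETinf, e ∉ F ∧ v ∈ e}).ncard

/-- The threshold weighting on `T_∞` induced by the uniform random walk:
`2/3` on edges containing a leaf, `4/3` otherwise. -/
def thetaT : Sym2 Vtx → ℝ := fun e => if ∃ v ∈ e, v.1 = 0 then 2 / 3 else 4 / 3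

lemma finite_vset (F : Finset (Sym2 V)) : (vset F).Finite :=
  (F.biUnion Sym2.toFinset).finite_toSet.subset fun v ⟨e, he, hv⟩ => by
    simpa using ⟨e, he, hv⟩

lemma edge_parentV_injective : Function.Injective fun v : Vtx => s(v, parentV v) := by
  intro v w h
  rcases Sym2.eq_iff.1 h with ⟨h, -⟩ | ⟨h₁, h₂⟩
  · exact h
  · have h₃ := congrArg Prod.fst h₁
    have h₄ := congrArg Prod.fst h₂
    simp only [parentV] at h₃ h₄
    omega

/-- Double counting of incidences: the degrees of a finite graph on `T_∞` sum to twice the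
number of edges. -/
lemma sum_degree_eq (H : Finset (Sym2 Vtx)) (hH : (H : Set (Sym2 Vtx)) ⊆ ETinf) :
    ∑ v ∈ (finite_vset H).toFinset, (H.filter (v ∈ ·)).card = 2 * H.card := by
  have h := Finset.sum_card_bipartiteAbove_eq_sum_card_bipartiteBelow
    (s := (finite_vset H).toFinset) (t := H) (fun (v : Vtx) (e : Sym2 Vtx) => v ∈ e)
  simp only [Finset.bipartiteAbove, Finset.bipartiteBelow] at h
  rw [h, Finset.sum_const_nat (m := 2), mul_comm]
  intro e he
  obtain ⟨v, rfl⟩ := hH he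
  have hne : v ≠ parentV v := fun h => by
    have := congrArg Prod.fst h
    simp [parentV] at this
  rw [← Finset.card_pair hne]
  congr 1
  ext w
  simp only [Finset.mem_filter, Set.Finite.mem_toFinset, Finset.mem_insert,
    Finset.mem_singleton, Sym2.mem_iff, and_iff_right_iff_imp]
  exact fun hw => ⟨_, he, Sym2.mem_iff.2 hw⟩

/-- A non-empty finite subgraph of `T_∞` has more vertices than edges. -/
lemma card_lt_card_vset (H : Finset (Sym2 Vtx)) (hH : (H : Set (Sym2 Vtx)) ⊆ ETinf)
    (hne : H.Nonempty) : H.card < (finite_vset H).toFinset.card := by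
  have hV : (finite_vset H).toFinset.Nonempty := by
    obtain ⟨e, he⟩ := hne
    obtain ⟨v, rfl⟩ := hH he
    exact ⟨v, (finite_vset H).mem_toFinset.2 ⟨_, he, Sym2.mem_mk_left _ _⟩⟩
  obtain ⟨t, ht, hmax⟩ := Finset.exists_max_image _ Prod.fst hV
  have hsub : H ⊆ ((finite_vset H).toFinset.erase t).image fun v => s(v, parentV v) := by
    intro e he
    obtain ⟨v, rfl⟩ := hH he
    refine Finset.mem_image.2 ⟨v, Finset.mem_erase.2 ⟨?_, ?_⟩, rfl⟩
    · rintro rfl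
      have := hmax (parentV v) ((finite_vset H).mem_toFinset.2 ⟨_, he, Sym2.mem_mk_right _ _⟩)
      simp [parentV] at this
    · exact (finite_vset H).mem_toFinset.2 ⟨_, he, Sym2.mem_mk_left _ _⟩
  exact ((Finset.card_le_card hsub).trans Finset.card_image_le).trans_lt
    (Finset.card_erase_lt_of_mem ht)

/-- A vertex above the leaf level all of whose `T_∞`-edges lie in `H` has degree at least `3`
in `H`. -/
lemma three_le_degree {H : Finset (Sym2 Vtx)} {v : Vtx} (hv : v.1 ≠ 0)
    (hint : ∀ e ∈ ETinf, v ∈ e → e ∈ H) : 3 ≤ (H.filter (v ∈ ·)).card := by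
  obtain ⟨j, m⟩ := v
  obtain ⟨j, rfl⟩ := Nat.exists_eq_succ_of_ne_zero hv
  have hl : parentV (j, 2 * m) = (j + 1, m) := by simp [parentV]
  have hr : parentV (j, 2 * m + 1) = (j + 1, m) := by simp [parentV]; omega
  let S : Finset Vtx := {(j + 1, m), (j, 2 * m), (j, 2 * m + 1)}
  have hS : S.card = 3 := Finset.card_eq_three.2 ⟨_, _, _, by simp, by simp, by simp, rfl⟩
  rw [← hS, ← Finset.card_image_of_injective S edge_parentV_injective]
  refine Finset.card_le_card (Finset.image_subset_iff.2 fun w hw => ?_)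
  have hmem : (j + 1, m) ∈ s(w, parentV w) := by
    simp only [S, Finset.mem_insert, Finset.mem_singleton] at hw
    rcases hw with rfl | rfl | rfl
    · exact Sym2.mem_mk_left _ _
    · exact hl ▸ Sym2.mem_mk_right _ _
    · exact hr ▸ Sym2.mem_mk_right _ _
  exact Finset.mem_filter.2 ⟨hint _ ⟨w, rfl⟩ hmem, hmem⟩

/-- If `H` is a non-empty finite subgraph of `T_∞` all of whose
connected components are ungrounded (equivalently, `H` contains no leaf of `T_∞`),
then `∂(H) ≥ (|E(H)| + 3)/2`. -/
theorem stmt3 (H : Finset (Sym2 Vtx)) (hH : (H : Set (Sym2 Vtx)) ⊆ ETinf)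
    (hne : H.Nonempty) (hungr : ∀ v ∈ vset H, v.1 ≠ 0) :
    ((H.card : ℝ) + 3) / 2 ≤ (bdry H : ℝ) := by
  set W := (finite_vset H).toFinset
  set B : Set Vtx := {v | ∃ e ∈ ETinf, e ∉ H ∧ v ∈ e}
  have hb : bdry H = (W.filter (· ∈ B)).card := by
    rw [bdry, ← Set.ncard_coe_finset]
    congr 1
    ext v
    simp [W, B]
  have hsplit : (W.filter (· ∈ B)).card + (W.filter (· ∉ B)).card = W.card :=
    Finset.card_filter_add_card_filter_not _
  have hdeg : (W.filter (· ∈ B)).card • 1 + (W.filter (· ∉ B)).card • 3 ≤ 2 * H.card := by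
    rw [← sum_degree_eq H hH, ← Finset.sum_filter_add_sum_filter_not W (· ∈ B)]
    refine add_le_add (Finset.card_nsmul_le_sum _ _ _ fun v hv => ?_)
      (Finset.card_nsmul_le_sum _ _ _ fun v hv => ?_)
    · obtain ⟨e, he, hve⟩ := (finite_vset H).mem_toFinset.1 (Finset.mem_filter.1 hv).1
      exact Finset.card_pos.2 ⟨e, Finset.mem_filter.2 ⟨he, hve⟩⟩
    · obtain ⟨hvW, hvB⟩ := Finset.mem_filter.1 hv
      refine three_le_degree (hungr v ((finite_vset H).mem_toFinset.1 hvW)) fun e he hve => ?_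
      by_contra h
      exact hvB ⟨e, he, h, hve⟩
  have hlt : H.card < W.card := card_lt_card_vset H hH hne
  have key : H.card + 3 ≤ 2 * bdry H := by
    simp only [smul_eq_mul] at hdeg
    omega
  have : (H.card : ℝ) + 3 ≤ 2 * bdry H := by exact_mod_cast key
  linarith

end Paper

end
end

section
/- Let 1 ≤ t ≤ ℓ be integers, let z ∈ V_ℓ, and let A be a join-tree over T_∞ such that T_z ⊆ Gr(A). Then at least one of the following holds: (i) there exists D ⪯ A with ∂(Gr(D)) ≥ t and λ(Gr(D)) + ∂(Gr(D)) ≥ ℓ; (ii) there exists C ≺ A with λ((Gr(C) ∩ T_z) ⊖ {z}) + ∂((Gr(C) ∩ T_z) ⊖ {z}) ≥ ℓ − t; (iii) there exists E ≺ A with ∂(Gr(E)) ≥ ℓ − t. Here Gr(C) ∩ T_z denotes the subgraph with edge set E(Gr(C)) ∩ E(T_z). -/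
open scoped Classical

noncomputable section

namespace Paper

variable {V : Type*}

namespace JoinTree

/-- The graph of a join-tree: the finite subgraph whose edges are the labels
occurring in the tree. -/
def graph : JoinTree V → Finset (Sym2 V)
  | leaf none => ∅
  | leaf (some e) => {e}
  | node B C => graph B ∪ graph C

/-- `Sub D A` means `D ⪯ A`: `D = ⟨⟩`, or `D = A`, or `D` is a sub-join-tree of a
child of `A`. -/
inductive Sub : JoinTree V → JoinTree V → Prop
  | empty (A : JoinTree V) : Sub (leaf none) A
  | refl (A : JoinTree V) : Sub A A
  | left {D B C : JoinTree V} : Sub D B → Sub D (node B C)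
  | right {D B C : JoinTree V} : Sub D C → Sub D (node B C)

/-- `SubP D A` means `D ≺ A`, i.e. `D ⪯ A` and `D ≠ A`. -/
def SubP (D A : JoinTree V) : Prop := Sub D A ∧ D ≠ A

/-- A join-tree is atomic if it is a single (labeled or unlabeled) leaf. -/
def Atomic (A : JoinTree V) : Prop := ∃ l, A = leaf l

/-- Replace every leaf label not belonging to `E'` by `⊥`. -/
def prune : JoinTree V → Finset (Sym2 V) → JoinTree V
  | leaf none, _ => leaf none
  | leaf (some e), E' => if e ∈ E' then leaf (some e) else leaf none
  | node B C, E' => node (prune B E') (prune C E')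

/-- `A ⊖ S`: delete all leaf labels except those belonging to `Gr(A) ⊖ S`. -/
def elimT (A : JoinTree V) (S : Set V) : JoinTree V := prune A (Paper.elimS A.graph S)

/-- `A` is a join-tree over the graph with edge set `E` (all labels come from `E`). -/
def Over (E : Set (Sym2 V)) (A : JoinTree V) : Prop := (A.graph : Set (Sym2 V)) ⊆ E

lemma graph_mono_of_sub {D A : JoinTree V} (h : Sub D A) : D.graph ⊆ A.graph := by
  induction h with
  | empty A => intro e he; simp [graph] at he
  | refl A => exact Finset.Subset.refl _
  | left _ ih => exact ih.trans Finset.subset_union_left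
  | right _ ih => exact ih.trans Finset.subset_union_right

end JoinTree

open JoinTree

/-- The `i`-th ancestor of `v`. -/
def anc (v : Vtx) (i : ℕ) : Vtx := (v.1 + i, v.2 / 2 ^ i)

lemma anc_anc (v : Vtx) (i j : ℕ) : anc (anc v i) j = anc v (i + j) := by
  simp [anc, Nat.div_div_eq_div_mul, pow_add, add_assoc]

lemma anc_zero (v : Vtx) : anc v 0 = v := by simp [anc]

lemma anc_one (v : Vtx) : anc v 1 = parentV v := by simp [anc, parentV]

lemma parentV_anc (v : Vtx) (i : ℕ) : parentV (anc v i) = anc v (i + 1) := by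
  rw [← anc_one, anc_anc]

lemma desc_iff {v x : Vtx} : Desc v x ↔ ∃ i, x = anc v i := by
  constructor
  · rintro ⟨h1, h2⟩
    exact ⟨x.1 - v.1, Prod.ext (by simp [anc]; omega) (by simp [anc, h2])⟩
  · rintro ⟨i, rfl⟩
    exact ⟨by simp [anc], by simp [anc]⟩

lemma Desc.refl (v : Vtx) : Desc v v := desc_iff.2 ⟨0, (anc_zero v).symm⟩

lemma Desc.trans {u v w : Vtx} (h : Desc u v) (h' : Desc v w) : Desc u w := by
  obtain ⟨i, rfl⟩ := desc_iff.1 h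
  obtain ⟨j, rfl⟩ := desc_iff.1 h'
  exact desc_iff.2 ⟨i + j, anc_anc _ _ _⟩

lemma desc_parentV (v : Vtx) : Desc v (parentV v) := desc_iff.2 ⟨1, (anc_one v).symm⟩

lemma desc_anc (v : Vtx) (i : ℕ) : Desc v (anc v i) := desc_iff.2 ⟨i, rfl⟩

lemma Desc.parentV_of_ne {v x : Vtx} (h : Desc v x) (hne : v ≠ x) : Desc (parentV v) x := by
  obtain ⟨i, rfl⟩ := desc_iff.1 h
  cases i with
  | zero => exact absurd (anc_zero v).symm hne
  | succ i => exact desc_iff.2 ⟨i, by rw [← anc_one, anc_anc, add_comm]⟩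

lemma Desc.eq_of_le {v x : Vtx} (h : Desc v x) (hle : x.1 ≤ v.1) : v = x := by
  obtain ⟨i, rfl⟩ := desc_iff.1 h
  have : i = 0 := by simp [anc] at hle; omega
  subst this
  exact (anc_zero v).symm

/-- Ancestors of a common vertex are comparable. -/
lemma Desc.of_le {v w x : Vtx} (hw : Desc v w) (hx : Desc v x) (hle : w.1 ≤ x.1) :
    Desc w x := by
  obtain ⟨i, rfl⟩ := desc_iff.1 hw
  obtain ⟨j, rfl⟩ := desc_iff.1 hx
  have : i ≤ j := by simp [anc] at hle; omega
  exact desc_iff.2 ⟨j - i, by rw [anc_anc]; congr 1; omega⟩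

lemma exists_sibling (c : Vtx) : ∃ s : Vtx, s.1 = c.1 ∧ s ≠ c ∧ parentV s = parentV c ∧
    ∀ w, parentV w = parentV c → w = c ∨ w = s := by
  obtain ⟨a, b⟩ := c
  rcases Nat.even_or_odd' b with ⟨q, h | h⟩
  · refine ⟨(a, b + 1), rfl, by simp, ?_, ?_⟩
    · simp [parentV]; omega
    · rintro ⟨a', b'⟩ hw
      simp [parentV] at hw ⊢; omega
  · refine ⟨(a, b - 1), rfl, by simp; omega, ?_, ?_⟩
    · simp [parentV]; omega
    · rintro ⟨a', b'⟩ hw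
      simp [parentV] at hw ⊢; omega

/-- The vertices of `F` incident to an edge of `T_∞` outside `F`. -/
def bdrySet (F : Finset (Sym2 Vtx)) : Set Vtx :=
  vset F ∩ {v | ∃ e ∈ ETinf, e ∉ F ∧ v ∈ e}

lemma vset_finite {W : Type*} (F : Finset (Sym2 W)) : (vset F).Finite := by
  have h : vset F = ⋃ e ∈ F, {v | v ∈ e} := by
    ext v; simp [vset]
  rw [h]
  refine F.finite_toSet.biUnion fun e _ => ?_
  induction e with
  | _ a b => exact (Set.toFinite {a, b}).subset fun v hv => by simpa using hv

lemma bdrySet_finite (F : Finset (Sym2 Vtx)) : (bdrySet F).Finite :=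
  (vset_finite F).subset Set.inter_subset_left

lemma mem_of_notMem_bdrySet {F : Finset (Sym2 Vtx)} {v w : Vtx} (hv : v ∈ vset F)
    (hb : v ∉ bdrySet F) (hw : v ∈ s(w, parentV w)) : s(w, parentV w) ∈ F := by
  by_contra h
  exact hb ⟨hv, _, ⟨w, rfl⟩, h, hw⟩

/-- A subtree of `T_∞` that meets `F` and has no boundary vertex of `F` lies in `F`. -/
lemma txCont_of_forall_notMem_bdrySet {F : Finset (Sym2 Vtx)} {u w : Vtx} (hw : Desc w u)
    (hwF : w ∈ vset F) (hb : ∀ v, Desc v u → v ∉ bdrySet F) : TxCont u F := by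
  have hu : u ∈ vset F := by
    obtain ⟨i, rfl⟩ := desc_iff.1 hw
    have key : ∀ j ≤ i, anc w j ∈ vset F := by
      intro j
      induction j with
      | zero => intro _; rwa [anc_zero]
      | succ j ih =>
        intro hj
        have hd : Desc (anc w j) (anc w i) :=
          (desc_anc w j).of_le hw (by simp [anc]; omega)
        have := mem_of_notMem_bdrySet (w := anc w j) (ih (by omega)) (hb _ hd) (by simp)
        exact ⟨_, this, by rw [parentV_anc]; simp⟩
    exact key i le_rfl
  have hdown : ∀ i v, u = anc v i → v ∈ vset F := by
    intro i
    induction i with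
    | zero => intro v hv; rw [anc_zero] at hv; rwa [← hv]
    | succ i ih =>
      intro v hv
      have hv' : u = anc (parentV v) i := by rw [hv, ← anc_one, anc_anc, add_comm]
      have := mem_of_notMem_bdrySet (w := v) (ih _ hv') (hb _ (desc_iff.2 ⟨i, hv'⟩)) (by simp)
      exact ⟨_, this, by simp⟩
  refine ⟨?_, fun _ => hu⟩
  rintro _ ⟨v, hv, -, rfl⟩
  obtain ⟨i, hi⟩ := desc_iff.1 hv
  exact mem_of_notMem_bdrySet (hdown i v hi) (hb v hv) (by simp)

lemma TxCont.mem_vset {F : Finset (Sym2 Vtx)} {x : Vtx} (h : TxCont x F) : x ∈ vset F := by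
  rcases Nat.eq_zero_or_pos x.1 with h0 | h0
  · exact h.2 h0
  · have hp : parentV (x.1 - 1, x.2 * 2) = x := by
      apply Prod.ext <;> simp [parentV]; omega
    refine ⟨s((x.1 - 1, x.2 * 2), x), h.1 ⟨(x.1 - 1, x.2 * 2), ?_, ?_, by rw [hp]⟩, by simp⟩
    · simpa [hp] using desc_parentV (x.1 - 1, x.2 * 2)
    · intro hx
      have := congrArg Prod.fst hx
      simp at this; omega

lemma TxCont.le_lam {F : Finset (Sym2 Vtx)} {x : Vtx} (h : TxCont x F) : x.1 ≤ lam F := by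
  refine le_csSup ?_ ⟨x, rfl, h⟩
  refine (((vset_finite F).image Prod.fst).subset ?_).bddAbove
  rintro k ⟨y, rfl, hy⟩
  exact ⟨y, hy.mem_vset, rfl⟩

/-- A finite subgraph of `T_∞` covering at least `2 ^ m` leaves satisfies `λ + ∂ ≥ m`. -/
lemma le_lam_add_bdry {F : Finset (Sym2 Vtx)} {m : ℕ} (L : Finset Vtx)
    (hL : ∀ v ∈ L, v.1 = 0 ∧ v ∈ vset F) (hm : 2 ^ m ≤ L.card) : m ≤ lam F + bdry F := by
  set h := lam F + 1 with hh
  have hfib : ∀ q ∈ L.image (fun v => v.2 / 2 ^ h),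
      (L.filter fun v => v.2 / 2 ^ h = q).card ≤ 2 ^ h := by
    intro q _
    have hsub : (L.filter fun v => v.2 / 2 ^ h = q) ⊆
        (Finset.range (2 ^ h)).image fun r => ((0, 2 ^ h * q + r) : Vtx) := by
      intro v hv
      obtain ⟨hvL, rfl⟩ := Finset.mem_filter.1 hv
      refine Finset.mem_image.2 ⟨v.2 % 2 ^ h, Finset.mem_range.2 (Nat.mod_lt _ (by positivity)), ?_⟩
      rw [Nat.div_add_mod]
      exact Prod.ext (hL v hvL).1.symm rfl
    exact (Finset.card_le_card hsub).trans (Finset.card_image_le.trans (by simp))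
  have h1 : L.card ≤ 2 ^ h * (L.image (fun v => v.2 / 2 ^ h)).card :=
    Finset.card_le_mul_card_image L _ hfib
  have h2 : (L.image (fun v => v.2 / 2 ^ h)).card ≤ bdry F := by
    have hsub : L.image (fun v => v.2 / 2 ^ h) ⊆
        (bdrySet_finite F).toFinset.image fun w => w.2 / 2 ^ (h - w.1) := by
      intro q hq
      obtain ⟨v, hv, rfl⟩ := Finset.mem_image.1 hq
      by_contra hcon
      have hd : Desc v (h, v.2 / 2 ^ h) := ⟨by simp [(hL v hv).1], by simp [(hL v hv).1]⟩
      have hc : TxCont (h, v.2 / 2 ^ h) F := by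
        refine txCont_of_forall_notMem_bdrySet hd (hL v hv).2 fun w hw hwb => hcon ?_
        exact Finset.mem_image.2 ⟨w, by simpa using hwb, hw.2⟩
      have := hc.le_lam
      simp only at this
      omega
    refine (Finset.card_le_card hsub).trans (Finset.card_image_le.trans ?_)
    rw [← Set.ncard_eq_toFinset_card _ (bdrySet_finite F)]
    exact le_rfl
  have h3 : 2 ^ m ≤ 2 ^ h * bdry F := hm.trans (h1.trans (Nat.mul_le_mul_left _ h2))
  have h4 : ∀ b : ℕ, 2 * b ≤ 2 ^ b := by
    intro b
    cases b with
    | zero => simp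
    | succ b => rw [pow_succ]; have := Nat.lt_two_pow_self (n := b); omega
  have h5 : 2 ^ m ≤ 2 ^ (lam F + bdry F) := by
    calc 2 ^ m ≤ 2 ^ h * bdry F := h3
      _ = 2 ^ lam F * (2 * bdry F) := by rw [hh, pow_succ]; ring
      _ ≤ 2 ^ lam F * 2 ^ bdry F := Nat.mul_le_mul_left _ (h4 _)
      _ = _ := (pow_add _ _ _).symm
  exact (Nat.pow_le_pow_iff_right (by norm_num)).1 h5

/-- `x` is a descendant of `z` and the path from `x` up to `z` lies in `F`. -/
def Joined (F : Finset (Sym2 Vtx)) (z x : Vtx) : Prop :=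
  Desc x z ∧ ∀ w, Desc x w → Desc w z → w ≠ z → s(w, parentV w) ∈ F

lemma Joined.up {F : Finset (Sym2 Vtx)} {z x y : Vtx} (h : Joined F z x) (hy : Desc x y)
    (hz : Desc y z) : Joined F z y :=
  ⟨hz, fun w hw => h.2 w (hy.trans hw)⟩

lemma Joined.down {F : Finset (Sym2 Vtx)} {z x v : Vtx} (h : Joined F z x)
    (hx : TxE x ⊆ (F : Set (Sym2 Vtx))) (hv : Desc v x) : Joined F z v := by
  refine ⟨hv.trans h.1, fun w hw hwz hne => ?_⟩
  rcases le_total x.1 w.1 with hle | hle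
  · exact h.2 w (hv.of_le hw hle) hwz hne
  · have hwx := hw.of_le hv hle
    by_cases heq : w = x
    · exact h.2 w (heq ▸ Desc.refl _) hwz hne
    · exact hx ⟨w, hwx, heq, rfl⟩

/-- If some leaf below `z` is joined to `z` in `F`, then some complete subtree `T_x ⊆ F` is
joined to `z`, and the boundary of `F` has at least as many vertices as the levels
between `x` and `z`. -/
lemma exists_txCont_le_bdry {F : Finset (Sym2 Vtx)} {z v : Vtx} (hz : 0 < z.1)
    (hv0 : v.1 = 0) (hv : Joined F z v) :
    ∃ x, Joined F z x ∧ TxCont x F ∧ z.1 ≤ x.1 + bdry F := by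
  have hvz : v ≠ z := by rintro rfl; omega
  have hvc : TxCont v F := by
    refine ⟨?_, fun _ => ⟨_, hv.2 v (Desc.refl v) hv.1 hvz, by simp⟩⟩
    rintro _ ⟨w, hw, hne, rfl⟩
    exact absurd (hw.eq_of_le (by omega)) hne
  obtain ⟨k, ⟨x, hxk, hx, hxc⟩, hmax⟩ : ∃ k, (∃ x : Vtx, x.1 = k ∧ Joined F z x ∧ TxCont x F) ∧
      ∀ y : Vtx, Joined F z y → TxCont y F → y.1 ≤ k := by
    let P : ℕ → Prop := fun k => ∃ x : Vtx, x.1 = k ∧ Joined F z x ∧ TxCont x F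
    have hP : P (Nat.findGreatest P z.1) :=
      Nat.findGreatest_spec (P := P) (m := 0) (Nat.zero_le _) ⟨v, hv0, hv, hvc⟩
    exact ⟨_, hP, fun y hy hyc => Nat.le_findGreatest hy.1.1 ⟨y, rfl, hy, hyc⟩⟩
  refine ⟨x, hx, hxc, ?_⟩
  have key : ∀ i, x.1 + i ≤ z.1 → i ≤ (bdrySet F ∩ {w | Desc w (anc x i)}).ncard := by
    intro i
    induction i with
    | zero => intro _; exact Nat.zero_le _
    | succ i ih =>
      intro hi
      have hci : (anc x i).1 = x.1 + i := rfl
      have hyi : (anc x (i + 1)).1 = x.1 + (i + 1) := rfl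
      have hpc := parentV_anc x i
      have hxc' : Desc x (anc x i) := desc_anc x i
      have hxy : Desc x (anc x (i + 1)) := desc_anc x (i + 1)
      generalize anc x (i + 1) = y at *
      have hcz : Desc (anc x i) z := hxc'.of_le hx.1 (by omega)
      have hyz : Desc y z := hxy.of_le hx.1 (by omega)
      have hcy : Desc (anc x i) y := hpc ▸ desc_parentV _
      obtain ⟨w, hwb, hwy, hwc⟩ : ∃ w ∈ bdrySet F, Desc w y ∧ ¬ Desc w (anc x i) := by
        by_contra! hcon
        obtain ⟨s, hs1, hsne, hsp, hsib⟩ := exists_sibling (anc x i)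
        rw [hpc] at hsp hsib
        have hce : s(anc x i, y) ∈ F := by
          have := hx.2 _ hxc' hcz (by rintro h; rw [h] at hci; omega)
          rwa [hpc] at this
        have hyb : y ∉ bdrySet F := fun h => by
          have := (hcon y h (Desc.refl y)).1
          omega
        have hse : s(s, y) ∈ F := by
          have := mem_of_notMem_bdrySet (w := s) ⟨_, hce, by simp⟩ hyb (by simp [hsp])
          rwa [hsp] at this
        have hsy : Desc s y := hsp ▸ desc_parentV s
        have hsc : TxCont s F := by
          refine txCont_of_forall_notMem_bdrySet (Desc.refl s) ⟨_, hse, by simp⟩ ?_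
          intro w hw hwb
          exact hsne ((hw.of_le (hcon w hwb (hw.trans hsy)) hs1.le).eq_of_le hs1.ge)
        have hsj : Joined F z s := by
          refine ⟨hsy.trans hyz, fun w hw hwz hne => ?_⟩
          by_cases hws : s = w
          · rw [← hws, hsp]; exact hse
          · have := hw.parentV_of_ne hws
            rw [hsp] at this
            exact hx.2 w (hxy.trans this) hwz hne
        have hi0 : i = 0 := by have := hmax s hsj hsc; omega
        subst hi0
        rw [anc_zero] at *
        have hyc : TxCont y F := by
          refine ⟨?_, fun h => by omega⟩
          rintro _ ⟨w, hw, hne, rfl⟩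
          have hchild : ∀ j u, y = anc u (j + 1) → Desc u x ∨ Desc u s := by
            intro j
            induction j with
            | zero =>
              intro u hu
              rw [anc_one] at hu
              rcases hsib u hu.symm with rfl | rfl
              · exact .inl (Desc.refl _)
              · exact .inr (Desc.refl _)
            | succ j ihj =>
              intro u hu
              have : y = anc (parentV u) (j + 1) := by
                rw [hu, ← anc_one, anc_anc]; congr 1; omega
              exact (ihj _ this).imp (desc_parentV u).trans (desc_parentV u).trans
          obtain ⟨j, hj⟩ := desc_iff.1 hw
          cases j with
          | zero => exact absurd (by rw [hj, anc_zero]) hne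
          | succ j =>
            rcases hchild j w hj with h | h
            · by_cases hwx : w = x
              · rw [hwx, hpc]; exact hce
              · exact hxc.1 ⟨w, h, hwx, rfl⟩
            · by_cases hws : w = s
              · rw [hws, hsp]; exact hse
              · exact hsc.1 ⟨w, h, hws, rfl⟩
        have := hmax y (hx.up hxy hyz) hyc
        omega
      refine Nat.succ_le_of_lt ((ih (by omega)).trans_lt (Set.ncard_lt_ncard ?_
        ((bdrySet_finite F).subset Set.inter_subset_left)))
      exact ⟨fun u hu => ⟨hu.1, hu.2.trans hcy⟩, fun h => hwc (h ⟨hwb, hwy⟩).2⟩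
  have h1 := key (z.1 - x.1) (by have := hx.1.1; omega)
  have h2 : (bdrySet F ∩ {w | Desc w (anc x (z.1 - x.1))}).ncard ≤ bdry F :=
    Set.ncard_le_ncard Set.inter_subset_left (bdrySet_finite F)
  omega

/-- Reachability of the root inside `T_z` forces the whole upward path to be present. -/
lemma joined_of_reachable {F : Finset (Sym2 Vtx)} {z u : Vtx}
    (hF : (F : Set (Sym2 Vtx)) ⊆ ETinf) (hu : Desc u z)
    (hr : (SimpleGraph.fromEdgeSet (F : Set (Sym2 Vtx))).Reachable u z) : Joined F z u := by
  refine ⟨hu, fun y hy hyz hne => ?_⟩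
  by_contra hnot
  have hclosed : ∀ a b, (SimpleGraph.fromEdgeSet (F : Set (Sym2 Vtx))).Adj a b →
      Desc a y → Desc b y := by
    intro a b hab ha
    rw [SimpleGraph.fromEdgeSet_adj] at hab
    obtain ⟨w, hw⟩ := hF hab.1
    rcases Sym2.eq_iff.1 hw with ⟨rfl, rfl⟩ | ⟨rfl, rfl⟩
    · refine ha.parentV_of_ne ?_
      rintro rfl
      exact hnot hab.1
    · exact (desc_parentV b).trans ha
  have hall : ∀ a b, (SimpleGraph.fromEdgeSet (F : Set (Sym2 Vtx))).Walk a b →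
      Desc a y → Desc b y := by
    intro a b p
    induction p with
    | nil => exact id
    | cons h _ ih => exact fun ha => ih (hclosed _ _ h ha)
  obtain ⟨p⟩ := hr
  exact hne (hyz.eq_of_le (hall _ _ p hy).1)

/-- A leaf whose edge is in `G` but which is not joined to `z` is covered by the part of
`G ∩ T_z` avoiding `z`. -/
lemma mem_vset_elimS {G : Finset (Sym2 Vtx)} {z u : Vtx} (hu : Desc u z) (hne : u ≠ z)
    (he : s(u, parentV u) ∈ G) (hnj : ¬ Joined G z u) :
    u ∈ vset (elimS (G.filter (· ∈ TxE z)) {z}) := by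
  have hmem : s(u, parentV u) ∈ G.filter (· ∈ TxE z) :=
    Finset.mem_filter.2 ⟨he, u, hu, hne, rfl⟩
  have hnr : ¬ (SimpleGraph.fromEdgeSet
      ((G.filter (· ∈ TxE z) : Finset (Sym2 Vtx)) : Set (Sym2 Vtx))).Reachable u z := by
    intro hr
    have hj : Joined (G.filter (· ∈ TxE z)) z u := by
      refine joined_of_reachable ?_ hu hr
      intro e he
      obtain ⟨w, -, -, rfl⟩ := (Finset.mem_filter.1 (Finset.mem_coe.1 he)).2
      exact ⟨w, rfl⟩
    exact hnj ⟨hu, fun w h1 h2 h3 => (Finset.mem_filter.1 (hj.2 w h1 h2 h3)).1⟩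
  refine ⟨s(u, parentV u), Finset.mem_filter.2 ⟨hmem, ?_⟩, by simp⟩
  rintro v hv s rfl hr
  rcases Sym2.mem_iff.1 hv with rfl | rfl
  · exact hnr hr
  · refine hnr (SimpleGraph.Adj.reachable ?_ |>.trans hr)
    rw [SimpleGraph.fromEdgeSet_adj]
    refine ⟨hmem, fun h => ?_⟩
    have := congrArg Prod.fst h
    simp [parentV] at this

namespace JoinTree

/-- The number of internal nodes of a join-tree. -/
def nodes : JoinTree V → ℕ
  | leaf _ => 0
  | node B C => nodes B + nodes C + 1

lemma nodes_le_of_sub {D A : JoinTree V} (h : Sub D A) : D.nodes ≤ A.nodes := by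
  induction h with
  | empty A => simp [nodes]
  | refl A => exact le_rfl
  | left _ ih => simp only [nodes]; omega
  | right _ ih => simp only [nodes]; omega

lemma Sub.trans {D E A : JoinTree V} (h : Sub D E) (h' : Sub E A) : Sub D A := by
  induction h' with
  | empty A =>
    cases h with
    | empty => exact .empty _
    | refl => exact .empty _
  | refl A => exact h
  | left _ ih => exact .left (ih h)
  | right _ ih => exact .right (ih h)

lemma subP_left {B C A : JoinTree V} (h : Sub (node B C) A) : SubP B A := by
  refine ⟨(Sub.left (.refl B)).trans h, ?_⟩
  rintro rfl
  have := nodes_le_of_sub h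
  simp only [nodes] at this
  omega

lemma subP_right {B C A : JoinTree V} (h : Sub (node B C) A) : SubP C A := by
  refine ⟨(Sub.right (.refl C)).trans h, ?_⟩
  rintro rfl
  have := nodes_le_of_sub h
  simp only [nodes] at this
  omega

lemma mem_graph_node {B C : JoinTree V} {e : Sym2 V} :
    e ∈ (node B C).graph ↔ e ∈ B.graph ∨ e ∈ C.graph := by
  simp [graph]

lemma card_graph_leaf_le (l : Option (Sym2 V)) : (leaf l).graph.card ≤ 1 := by
  cases l <;> simp [graph]

end JoinTree

lemma one_lt_card_of_txCont {F : Finset (Sym2 Vtx)} {x : Vtx} (hx : 0 < x.1)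
    (h : TxCont x F) : 1 < F.card := by
  have hchild : ∀ b, b < 2 → s(((x.1 - 1, x.2 * 2 + b) : Vtx), x) ∈ F := by
    intro b hb
    have hp : parentV (x.1 - 1, x.2 * 2 + b) = x := by
      apply Prod.ext <;> simp [parentV] <;> omega
    refine h.1 ⟨(x.1 - 1, x.2 * 2 + b), ?_, ?_, by rw [hp]⟩
    · simpa [hp] using desc_parentV (x.1 - 1, x.2 * 2 + b)
    · intro hx
      have := congrArg Prod.fst hx
      simp at this; omega
  refine Finset.one_lt_card.2 ⟨_, hchild 0 (by omega), _, hchild 1 (by omega), ?_⟩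
  intro h
  rcases Sym2.eq_iff.1 h with ⟨h, -⟩ | ⟨h, -⟩
  · have := congrArg Prod.snd h
    simp at this
  · have := congrArg Prod.fst h
    simp at this; omega

/-- The leaves of `T_x`. -/
def leavesBelow (x : Vtx) : Finset Vtx :=
  (Finset.range (2 ^ x.1)).image fun r => ((0, 2 ^ x.1 * x.2 + r) : Vtx)

lemma card_leavesBelow (x : Vtx) : (leavesBelow x).card = 2 ^ x.1 := by
  rw [leavesBelow, Finset.card_image_of_injective _ fun a b h => by simpa using h]
  simp

lemma desc_of_mem_leavesBelow {x v : Vtx} (h : v ∈ leavesBelow x) : v.1 = 0 ∧ Desc v x := by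
  obtain ⟨r, hr, rfl⟩ := Finset.mem_image.1 h
  refine ⟨rfl, Nat.zero_le _, ?_⟩
  have hr := Finset.mem_range.1 hr
  simp [Nat.mul_add_div, Nat.div_eq_of_lt hr]

/-- Let `1 ≤ t ≤ ℓ`, `z ∈ V_ℓ`, and let `A` be a join-tree over
`T_∞` with `T_z ⊆ Gr(A)`. Then (i) some `D ⪯ A` has `∂(D) ≥ t` and
`λ(D) + ∂(D) ≥ ℓ`; or (ii) some `C ≺ A` has
`λ((Gr(C) ∩ T_z) ⊖ {z}) + ∂((Gr(C) ∩ T_z) ⊖ {z}) ≥ ℓ − t`; or (iii) some `E ≺ A`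
has `∂(E) ≥ ℓ − t`. -/
theorem stmt7 (t ℓ : ℕ) (ht : 1 ≤ t) (htl : t ≤ ℓ) (z : Vtx) (hz : z.1 = ℓ)
    (A : JoinTree Vtx) (hover : Over ETinf A) (hTz : TxCont z A.graph) :
    (∃ D : JoinTree Vtx, Sub D A ∧ t ≤ bdry D.graph ∧
        ℓ ≤ lam D.graph + bdry D.graph) ∨
    (∃ C : JoinTree Vtx, SubP C A ∧
        ℓ - t ≤ lam (elimS (C.graph.filter (· ∈ TxE z)) {z})
              + bdry (elimS (C.graph.filter (· ∈ TxE z)) {z})) ∨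
    (∃ E' : JoinTree Vtx, SubP E' A ∧ ℓ - t ≤ bdry E'.graph) := by
  by_contra! hcon
  obtain ⟨h1, h2, -⟩ := hcon
  have main : ∀ D : JoinTree Vtx, Sub D A → ∀ v : Vtx, v.1 = 0 → ¬ Joined D.graph z v := by
    intro D
    induction D with
    | leaf l =>
      intro hD v hv0 hv
      obtain ⟨x, hx, hxc, hb⟩ := exists_txCont_le_bdry (by omega) hv0 hv
      have := hxc.le_lam
      have hbt : bdry (leaf l).graph < t := by
        by_contra! hle
        have := h1 _ hD hle
        omega
      have h3 := one_lt_card_of_txCont (by omega) hxc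
      have h4 := card_graph_leaf_le l
      omega
    | node B C ihB ihC =>
      intro hD v hv0 hv
      obtain ⟨x, hx, hxc, hb⟩ := exists_txCont_le_bdry (by omega) hv0 hv
      have := hxc.le_lam
      have hbt : bdry (node B C).graph < t := by
        by_contra! hle
        have := h1 _ hD hle
        omega
      have hB := subP_left hD
      have hC := subP_right hD
      have hB2 := h2 B hB
      have hC2 := h2 C hC
      have hcover : ∀ u ∈ leavesBelow x,
          u ∈ vset (elimS (B.graph.filter (· ∈ TxE z)) {z}) ∨
          u ∈ vset (elimS (C.graph.filter (· ∈ TxE z)) {z}) := by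
        intro u hu
        obtain ⟨hu0, hux⟩ := desc_of_mem_leavesBelow hu
        have huz := hux.trans hx.1
        have hxne : u ≠ x := by rintro rfl; omega
        have hzne : u ≠ z := by rintro rfl; omega
        have he := hxc.1 ⟨u, hux, hxne, rfl⟩
        rcases mem_graph_node.1 (Finset.mem_coe.1 he) with he | he
        · exact .inl (mem_vset_elimS huz hzne he (ihB hB.1 u hu0))
        · exact .inr (mem_vset_elimS huz hzne he (ihC hC.1 u hu0))
      set GB := elimS (B.graph.filter (· ∈ TxE z)) {z}
      set GC := elimS (C.graph.filter (· ∈ TxE z)) {z}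
      have hcard := card_leavesBelow x
      have hsplit : (leavesBelow x).card ≤ ((leavesBelow x).filter (· ∈ vset GB)).card +
          ((leavesBelow x).filter (· ∈ vset GC)).card := by
        refine (Finset.card_le_card ?_).trans (Finset.card_union_le _ _)
        intro u hu
        simpa [hu] using hcover u hu
      have hpow : 2 * 2 ^ (ℓ - t) ≤ 2 ^ x.1 := by
        rw [← pow_succ']
        exact Nat.pow_le_pow_right (by norm_num) (by omega)
      have hfilter : ∀ G : Finset (Sym2 Vtx), ∀ u ∈ (leavesBelow x).filter (· ∈ vset G),
          u.1 = 0 ∧ u ∈ vset G := fun G u hu =>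
        ⟨(desc_of_mem_leavesBelow (Finset.mem_filter.1 hu).1).1, (Finset.mem_filter.1 hu).2⟩
      rcases le_or_gt (2 ^ (ℓ - t)) ((leavesBelow x).filter (· ∈ vset GB)).card with h | h
      · have := le_lam_add_bdry _ (hfilter GB) h
        omega
      · have := le_lam_add_bdry (m := ℓ - t) _ (hfilter GC) (by omega)
        omega
  obtain ⟨v, hv⟩ : (leavesBelow z).Nonempty := by
    rw [← Finset.card_pos, card_leavesBelow]
    positivity
  obtain ⟨hv0, hvz⟩ := desc_of_mem_leavesBelow hv
  exact main A (.refl A) v hv0 ⟨hvz, fun w _ hw hne => hTz.1 ⟨w, hw, hne, rfl⟩⟩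

end Paper

end
end
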